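/- arXiv:2505.00229 — 6 statements merged into one kernel-verified Lean document; each statement's English description precedes it below -/
import Mathlib

section
/- Let n ≥ 1, let E be an irreflexive acyclic relation on Fin n, let C be a weight matrix for E and let C* be its Kleene star. Then for every vector z : Fin n → ℝ with z i ≥ 0 for all i, the vector x defined by x j := max_{1 ≤ i ≤ n} C* i j · z i satisfies the max-linear recursive structural equations: for every j, x j = max( max_{i ≠ j} C i j · x i , z j ). -/
open Finset MeasureTheory ProbabilityTheory Real
open scoped ENNReal NNReal

/-- A directed path from `i` to `j` (of length `ℓ ≥ 1`) with weight `w`: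
the product of the edge weights along the path. -/
def PathWeight {n : ℕ} (E : Fin n → Fin n → Prop) (C : Fin n → Fin n → ℝ)
    (i j : Fin n) (w : ℝ) : Prop :=
  ∃ (ℓ : ℕ) (v : ℕ → Fin n), 1 ≤ ℓ ∧ v 0 = i ∧ v ℓ = j ∧
    (∀ k < ℓ, E (v k) (v (k + 1))) ∧
    w = ∏ k ∈ Finset.range ℓ, C (v k) (v (k + 1))

/-- The relation `E` has no directed cycles. -/
def Acyclic {n : ℕ} (E : Fin n → Fin n → Prop) : Prop :=
  ∀ i : Fin n, ¬ ∃ (ℓ : ℕ) (v : ℕ → Fin n), 1 ≤ ℓ ∧ v 0 = i ∧ v ℓ = i ∧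
    ∀ k < ℓ, E (v k) (v (k + 1))

/-- `C` is a weight matrix for the edge relation `E`. -/
structure IsWeightMatrix {n : ℕ} (E : Fin n → Fin n → Prop) (C : Fin n → Fin n → ℝ) : Prop where
  diag : ∀ i, C i i = 1
  edge_pos : ∀ i j, E i j → 0 < C i j
  nonedge : ∀ i j, i ≠ j → ¬ E i j → C i j = 0

/-- `S` is the Kleene star of the weight matrix `C`: `S i i = 1`, and for `i ≠ j`,
`S i j` is the maximum weight of a directed path from `i` to `j` if one exists, else `0`. -/
def IsKleeneStar {n : ℕ} (E : Fin n → Fin n → Prop) (C S : Fin n → Fin n → ℝ) : Prop :=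
  (∀ i, S i i = 1) ∧
  ∀ i j : Fin n, i ≠ j →
    ((∃ w, PathWeight E C i j w) →
      PathWeight E C i j (S i j) ∧ ∀ w, PathWeight E C i j w → w ≤ S i j) ∧
    ((¬ ∃ w, PathWeight E C i j w) → S i j = 0)


theorem pathWeight_single {n : ℕ} {E : Fin n → Fin n → Prop} {C : Fin n → Fin n → ℝ}
    {u j : Fin n} (h : E u j) : PathWeight E C u j (C u j) := by
  refine ⟨1, fun k => if k = 0 then u else j, le_rfl, by simp, by simp, ?_, by simp⟩
  intro k hk
  obtain rfl : k = 0 := by omega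
  simpa using h

theorem pathWeight_snoc {n : ℕ} {E : Fin n → Fin n → Prop} {C : Fin n → Fin n → ℝ}
    {i u j : Fin n} {w : ℝ} (hw : PathWeight E C i u w) (h : E u j) :
    PathWeight E C i j (w * C u j) := by
  obtain ⟨l, v, hl, h0, h1, hE, rfl⟩ := hw
  refine ⟨l + 1, fun k => if k ≤ l then v k else j, by omega, by simp [h0], by simp, ?_, ?_⟩
  · intro k hk
    by_cases hkl : k < l
    · have h2 : k ≤ l := hkl.le
      have h3 : k + 1 ≤ l := hkl
      simpa only [h2, h3, if_true] using hE k hkl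
    · obtain rfl : k = l := by omega
      simpa [h1] using h
  · rw [Finset.prod_range_succ]
    congr 1
    · apply Finset.prod_congr rfl
      intro k hk
      have hkl := Finset.mem_range.1 hk
      have h2 : k ≤ l := hkl.le
      have h3 : k + 1 ≤ l := hkl
      simp only [h2, h3, if_true]
    · simp [h1]

theorem pathWeight_split {n : ℕ} {E : Fin n → Fin n → Prop} {C : Fin n → Fin n → ℝ}
    {i j : Fin n} {w : ℝ} (hw : PathWeight E C i j w) :
    ∃ u, E u j ∧ ((i = u ∧ w = C u j) ∨ ∃ w', PathWeight E C i u w' ∧ w = w' * C u j) := by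
  obtain ⟨l, v, hl, h0, h1, hE, rfl⟩ := hw
  obtain ⟨m, rfl⟩ : ∃ m, l = m + 1 := ⟨l - 1, by omega⟩
  refine ⟨v m, ?_, ?_⟩
  · have := hE m (by omega)
    rwa [h1] at this
  · rcases Nat.eq_zero_or_pos m with rfl | hm
    · left
      exact ⟨h0.symm, by simp [← h1]⟩
    · right
      refine ⟨_, ⟨m, v, hm, h0, rfl, fun k hk => hE k (by omega), rfl⟩, ?_⟩
      rw [Finset.prod_range_succ, h1]

theorem pathWeight_ne {n : ℕ} {E : Fin n → Fin n → Prop} {C : Fin n → Fin n → ℝ}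
    (hacyc : Acyclic E) {i j : Fin n} {w : ℝ} (hw : PathWeight E C i j w) : i ≠ j := by
  rintro rfl
  obtain ⟨l, v, hl, h0, h1, hE, -⟩ := hw
  exact hacyc i ⟨l, v, hl, h0, h1, hE⟩

theorem pathWeight_pos {n : ℕ} {E : Fin n → Fin n → Prop} {C : Fin n → Fin n → ℝ}
    (hC : IsWeightMatrix E C) {i j : Fin n} {w : ℝ} (hw : PathWeight E C i j w) : 0 < w := by
  obtain ⟨l, v, hl, h0, h1, hE, rfl⟩ := hw
  exact Finset.prod_pos fun k hk => hC.edge_pos _ _ (hE k (Finset.mem_range.1 hk))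

/-- The vector `x j = max_i C* i j · z i` solves the max-linear recursive
structural equations `x j = max(max_{i ≠ j} C i j · x i, z j)`. -/
theorem stmt0 {n : ℕ} (hn : 1 ≤ n) (E : Fin n → Fin n → Prop)
    (hirr : ∀ i, ¬ E i i) (hacyc : Acyclic E)
    (C S : Fin n → Fin n → ℝ) (hC : IsWeightMatrix E C) (hS : IsKleeneStar E C S)
    (z : Fin n → ℝ) (hz : ∀ i, 0 ≤ z i) (x : Fin n → ℝ)
    (hx : ∀ j, x j = ⨆ i : Fin n, S i j * z i) :
    ∀ j : Fin n,
      x j = max (⨆ i : {i : Fin n // i ≠ j}, C i.1 j * x i.1) (z j) := by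
  have hSle : ∀ i j w, PathWeight E C i j w → w ≤ S i j := fun i j w hw =>
    (((hS.2 i j (pathWeight_ne hacyc hw)).1 ⟨w, hw⟩).2 w hw)
  have hS0 : ∀ i j, 0 ≤ S i j := by
    intro i j
    by_cases hij : i = j
    · subst hij; rw [hS.1]; exact zero_le_one
    · by_cases hp : ∃ w, PathWeight E C i j w
      · exact (pathWeight_pos hC ((hS.2 i j hij).1 hp).1).le
      · exact ((hS.2 i j hij).2 hp).ge
  have hle : ∀ i j, S i j * z i ≤ x j := by
    intro i j
    rw [hx]
    exact le_ciSup (f := fun i => S i j * z i) (Set.finite_range _).bddAbove i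
  have hx0 : ∀ j, 0 ≤ x j := fun j => (mul_nonneg (hS0 j j) (hz j)).trans (hle j j)
  intro j
  haveI : Nonempty (Fin n) := ⟨j⟩
  apply le_antisymm
  · rw [hx j]
    apply ciSup_le
    intro i
    by_cases hij : i = j
    · subst hij
      rw [hS.1, one_mul]
      exact le_max_right _ _
    · by_cases hp : ∃ w, PathWeight E C i j w
      · obtain ⟨u, hu, h⟩ := pathWeight_split ((hS.2 i j hij).1 hp).1
        have huj : u ≠ j := by
          rintro rfl
          exact hirr _ hu
        have key : S i j ≤ C u j * S i u := by
          rcases h with ⟨rfl, h⟩ | ⟨w', hw', h⟩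
          · rw [h, hS.1, mul_one]
          · rw [h, mul_comm]
            exact mul_le_mul_of_nonneg_left (hSle _ _ _ hw') (hC.edge_pos _ _ hu).le
        refine le_trans ?_ (le_max_left _ _)
        refine le_trans ?_ (le_ciSup (f := fun i : {i : Fin n // i ≠ j} => C i.1 j * x i.1)
          (Set.finite_range _).bddAbove ⟨u, huj⟩)
        calc S i j * z i ≤ C u j * S i u * z i := mul_le_mul_of_nonneg_right key (hz i)
          _ = C u j * (S i u * z i) := mul_assoc _ _ _
          _ ≤ C u j * x u := mul_le_mul_of_nonneg_left (hle i u) (hC.edge_pos _ _ hu).le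
      · rw [(hS.2 i j hij).2 hp, zero_mul]
        exact (hz j).trans (le_max_right _ _)
  · apply max_le
    · apply Real.iSup_le _ (hx0 j)
      rintro ⟨u, huj⟩
      show C u j * x u ≤ x j
      by_cases hu : E u j
      · obtain ⟨i, hi⟩ := exists_eq_ciSup_of_finite (f := fun i => S i u * z i)
        rw [hx u, ← hi]
        have key : C u j * S i u ≤ S i j := by
          by_cases hiu : i = u
          · subst hiu
            rw [hS.1, mul_one]
            exact hSle _ _ _ (pathWeight_single hu)
          · by_cases hp : ∃ w, PathWeight E C i u w
            · rw [mul_comm]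
              exact hSle _ _ _ (pathWeight_snoc ((hS.2 i u hiu).1 hp).1 hu)
            · rw [(hS.2 i u hiu).2 hp, mul_zero]
              exact hS0 i j
        calc C u j * (S i u * z i) = C u j * S i u * z i := (mul_assoc _ _ _).symm
          _ ≤ S i j * z i := mul_le_mul_of_nonneg_right key (hz i)
          _ ≤ x j := hle i j
      · rw [hC.nonedge u j huj hu, zero_mul]
        exact hx0 j
    · have := hle j j
      rwa [hS.1, one_mul] at this
end

section
/- Let n ≥ 1, let E be an irreflexive acyclic relation on Fin n, let C be a weight matrix for E and let C* be its Kleene star. Then for every vector z : Fin n → ℝ with z i ≥ 0 for all i, the vector x j := max_{1 ≤ i ≤ n} C* i j · z i is the UNIQUE solution of the recursive system: if y : Fin n → ℝ satisfies y j = max( max_{i ≠ j} C i j · y i , z j ) for every j, then y j = max_{1 ≤ i ≤ n} C* i j · z i for every j. -/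
open Finset MeasureTheory ProbabilityTheory Real
open scoped ENNReal NNReal

theorem PathWeight.single {n : ℕ} {E : Fin n → Fin n → Prop} (C : Fin n → Fin n → ℝ)
    {i j : Fin n} (h : E i j) : PathWeight E C i j (C i j) := by
  refine ⟨1, fun m => if m = 0 then i else j, le_rfl, by simp, by simp, ?_, by simp⟩
  intro k hk
  obtain rfl : k = 0 := by omega
  simpa using h

theorem PathWeight.snoc {n : ℕ} {E : Fin n → Fin n → Prop} {C : Fin n → Fin n → ℝ}
    {i j k : Fin n} {w : ℝ} (hp : PathWeight E C i j w) (h : E j k) :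
    PathWeight E C i k (w * C j k) := by
  obtain ⟨l, v, hl, h0, h1, hE, rfl⟩ := hp
  refine ⟨l + 1, fun m => if m ≤ l then v m else k, by omega, by simpa using h0, by simp, ?_, ?_⟩
  · intro m hm
    rcases Nat.lt_succ_iff_lt_or_eq.mp hm with hm | rfl
    · have h2 : m ≤ l := by omega
      have h3 : m + 1 ≤ l := by omega
      simpa only [h2, h3, if_true] using hE m hm
    · simpa [h1] using h
  · rw [Finset.prod_range_succ]
    congr 1
    · apply Finset.prod_congr rfl
      intro m hm
      have hm := Finset.mem_range.mp hm
      have h2 : m ≤ l := by omega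
      have h3 : m + 1 ≤ l := by omega
      simp only [h2, h3, if_true]
    · simp [h1]

theorem Acyclic.no_path {n : ℕ} {E : Fin n → Fin n → Prop} (h : Acyclic E)
    {C : Fin n → Fin n → ℝ} {i : Fin n} {w : ℝ} : ¬ PathWeight E C i i w := by
  rintro ⟨l, v, hl, h0, h1, hE, -⟩
  exact h i ⟨l, v, hl, h0, h1, hE⟩

theorem Acyclic.wf {n : ℕ} {E : Fin n → Fin n → Prop} (h : Acyclic E) : WellFounded E := by
  have key : ∀ i j, Relation.TransGen E i j → ∃ w, PathWeight E (fun _ _ => 1) i j w := by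
    intro i j hij
    induction hij with
    | single h => exact ⟨_, PathWeight.single _ h⟩
    | tail _ h ih => obtain ⟨w, hw⟩ := ih; exact ⟨_, hw.snoc h⟩
  haveI : Std.Irrefl (Relation.TransGen E) :=
    ⟨fun i hi => by obtain ⟨w, hw⟩ := key i i hi; exact h.no_path hw⟩
  have := Finite.wellFounded_of_trans_of_irrefl (Relation.TransGen E)
  exact Subrelation.wf (fun h => Relation.TransGen.single h) this

/-- The vector `x j = max_i C* i j · z i` is the UNIQUE solution of the recursive system. -/
theorem stmt1 {n : ℕ} (hn : 1 ≤ n) (E : Fin n → Fin n → Prop)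
    (hirr : ∀ i, ¬ E i i) (hacyc : Acyclic E)
    (C S : Fin n → Fin n → ℝ) (hC : IsWeightMatrix E C) (hS : IsKleeneStar E C S)
    (z : Fin n → ℝ) (hz : ∀ i, 0 ≤ z i) (y : Fin n → ℝ)
    (hy : ∀ j : Fin n, y j = max (⨆ i : {i : Fin n // i ≠ j}, C i.1 j * y i.1) (z j)) :
    ∀ j : Fin n, y j = ⨆ i : Fin n, S i j * z i := by
  have hbdd : ∀ j, BddAbove (Set.range fun i => S i j * z i) := fun j => Set.finite_range _ |>.bddAbove
  have hyz : ∀ j, z j ≤ y j := fun j => by rw [hy j]; exact le_max_right _ _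
  have hy0 : ∀ j, 0 ≤ y j := fun j => (hz j).trans (hyz j)
  have hstep : ∀ i j, E i j → C i j * y i ≤ y j := by
    intro i j hij
    have hne : i ≠ j := by rintro rfl; exact hirr _ hij
    rw [hy j]
    refine le_trans ?_ (le_max_left _ _)
    exact le_ciSup (f := fun i : {i : Fin n // i ≠ j} => C i.1 j * y i.1)
      (Set.finite_range _).bddAbove ⟨i, hne⟩
  have hpath : ∀ i j w, PathWeight E C i j w → w * y i ≤ y j := by
    rintro i j w ⟨l, v, -, rfl, rfl, hE, rfl⟩
    clear hbdd
    induction l with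
    | zero => simp
    | succ l ih =>
      have h1 := ih (fun k hk => hE k (by omega))
      have h2 := hE l (by omega)
      rw [Finset.prod_range_succ]
      calc _ = C (v l) (v (l+1)) * ((∏ k ∈ Finset.range l, C (v k) (v (k + 1))) * y (v 0)) := by ring
        _ ≤ C (v l) (v (l+1)) * y (v l) := mul_le_mul_of_nonneg_left h1 (hC.edge_pos _ _ h2).le
        _ ≤ _ := hstep _ _ h2
  have hpos : ∀ i j w, PathWeight E C i j w → 0 ≤ w := by
    rintro i j w ⟨l, v, -, rfl, rfl, hE, rfl⟩
    exact Finset.prod_nonneg fun k hk => (hC.edge_pos _ _ (hE k (Finset.mem_range.mp hk))).le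
  have hSle : ∀ i j w, PathWeight E C i j w → w ≤ S i j := by
    intro i j w hw
    have hne : i ≠ j := by rintro rfl; exact hacyc.no_path hw
    exact (((hS.2 i j hne).1 ⟨w, hw⟩).2 w hw)
  have hSnn : ∀ j, 0 ≤ ⨆ i, S i j * z i := by
    intro j
    refine le_trans ?_ (le_ciSup (hbdd j) j)
    simpa [hS.1 j] using hz j
  haveI : Nonempty (Fin n) := ⟨⟨0, hn⟩⟩
  intro j
  apply le_antisymm
  · induction j using hacyc.wf.induction with
    | _ j ih =>
    rw [hy j]
    apply max_le
    · apply Real.iSup_le _ (hSnn j)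
      rintro ⟨i, hne⟩
      by_cases hij : E i j
      · obtain ⟨k, hk⟩ := exists_eq_ciSup_of_finite (f := fun k => S k i * z k)
        have h1 := ih i hij
        rw [← hk] at h1
        have hc := hC.edge_pos _ _ hij
        refine (mul_le_mul_of_nonneg_left h1 hc.le).trans ?_
        by_cases hki : k = i
        · subst hki
          refine le_trans ?_ (le_ciSup (hbdd j) k)
          simp only [hS.1, one_mul]
          exact mul_le_mul_of_nonneg_right (hSle _ _ _ (PathWeight.single C hij)) (hz k)
        · by_cases hp : ∃ w, PathWeight E C k i w
          · have hw := ((hS.2 k i hki).1 hp).1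
            refine le_trans ?_ (le_ciSup (hbdd j) k)
            have := mul_le_mul_of_nonneg_right (hSle _ _ _ (hw.snoc hij)) (hz k)
            calc _ = S k i * C i j * z k := by ring
              _ ≤ _ := this
          · simpa [(hS.2 k i hki).2 hp] using hSnn j
      · simpa [hC.nonedge i j hne hij] using hSnn j
    · refine le_trans ?_ (le_ciSup (hbdd j) j)
      simp [hS.1 j]
  · apply ciSup_le
    intro i
    by_cases hij : i = j
    · subst hij; simpa [hS.1] using hyz i
    · by_cases hp : ∃ w, PathWeight E C i j w
      · have hw := ((hS.2 i j hij).1 hp).1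
        exact (mul_le_mul_of_nonneg_left (hyz i) (hpos _ _ _ hw)).trans (hpath _ _ _ hw)
      · simpa [(hS.2 i j hij).2 hp] using hy0 j
end

section
/- Let n ≥ 1, let E be an irreflexive acyclic relation on Fin n, let C be a weight matrix for E and let C* be its Kleene star. Then for every vector x : Fin n → ℝ with x i > 0 for all i, the following are equivalent: (1) x_j ≥ C i j · x_i for every pair (i,j) with E i j; (2) x_j ≥ C* i j · x_i for all pairs i, j. (Equivalently, in logarithmic coordinates, the polyhedra Q(C) and Q(C*) coincide.) -/
open Finset MeasureTheory ProbabilityTheory Real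
open scoped ENNReal NNReal

/-- For positive vectors `x`, satisfying the edge inequalities for `C` is equivalent to
satisfying all the inequalities for the Kleene star `C*` (i.e. `Q(C) = Q(C*)`). -/
theorem stmt4 {n : ℕ} (hn : 1 ≤ n) (E : Fin n → Fin n → Prop)
    (hirr : ∀ i, ¬ E i i) (hacyc : Acyclic E)
    (C S : Fin n → Fin n → ℝ) (hC : IsWeightMatrix E C) (hS : IsKleeneStar E C S)
    (x : Fin n → ℝ) (hx : ∀ i, 0 < x i) :
    (∀ i j : Fin n, E i j → C i j * x i ≤ x j) ↔
    (∀ i j : Fin n, S i j * x i ≤ x j) := by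
  constructor
  · intro h i j
    by_cases hij : i = j
    · subst hij
      rw [hS.1 i, one_mul]
    · by_cases hp : ∃ w, PathWeight E C i j w
      · obtain ⟨ℓ, v, -, h0, hl, hE, hw⟩ := (((hS.2 i j hij).1) hp).1
        have key : ∀ m, m ≤ ℓ →
            (∏ k ∈ Finset.range m, C (v k) (v (k + 1))) * x (v 0) ≤ x (v m) := by
          intro m
          induction m with
          | zero => intro _; simp
          | succ m ih =>
            intro hm
            have h1 := ih (by omega)
            have hEm := hE m (by omega)
            have h2 := mul_le_mul_of_nonneg_left h1 (hC.edge_pos _ _ hEm).le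
            have h3 := h _ _ hEm
            rw [Finset.prod_range_succ]
            linarith
        have := key ℓ le_rfl
        rw [h0, hl, ← hw] at this
        exact this
      · rw [(hS.2 i j hij).2 hp, zero_mul]
        exact (hx j).le
  · intro h i j hE
    have hij : i ≠ j := by
      rintro rfl
      exact hirr _ hE
    have hp : PathWeight E C i j (C i j) := by
      refine ⟨1, fun k => if k = 0 then i else j, le_rfl, by simp, by simp, ?_, by simp⟩
      intro k hk
      have : k = 0 := by omega
      subst this
      simpa using hE
    have h1 := ((hS.2 i j hij).1 ⟨_, hp⟩).2 _ hp
    exact (mul_le_mul_of_nonneg_right h1 (hx i).le).trans (h i j)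
end

section
/- Let n ≥ 1, let E be an irreflexive acyclic relation on Fin n and let C be a weight matrix for E. Then for every vector x : Fin n → ℝ with x i > 0 for all i, the following are equivalent: (1) x_j ≥ C i j · x_i for every pair (i,j) with E i j; (2) x is a fixed point of max-times multiplication by C, i.e., max_{1 ≤ i ≤ n} C i j · x_i = x_j for every j. In particular every point of the polytrope Q(C) lies in the tropical convex hull of the rows of C. -/
open Finset MeasureTheory ProbabilityTheory Real
open scoped ENNReal NNReal

/-- For positive vectors `x`, the edge inequalities for `C` hold iff `x` is a fixed point of
max-times multiplication by `C`; in particular every point of the polytrope `Q(C)` lies in the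
tropical convex hull of the rows of `C`. -/
theorem stmt6 {n : ℕ} (hn : 1 ≤ n) (E : Fin n → Fin n → Prop)
    (hirr : ∀ i, ¬ E i i) (hacyc : Acyclic E)
    (C : Fin n → Fin n → ℝ) (hC : IsWeightMatrix E C)
    (x : Fin n → ℝ) (hx : ∀ i, 0 < x i) :
    ((∀ i j : Fin n, E i j → C i j * x i ≤ x j) ↔
      (∀ j : Fin n, (⨆ i : Fin n, C i j * x i) = x j)) ∧
    ((∀ i j : Fin n, E i j → C i j * x i ≤ x j) →
      ∃ lam : Fin n → ℝ, (∀ i, 0 < lam i) ∧ ∀ j : Fin n, x j = ⨆ i : Fin n, lam i * C i j) := by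
  have key : (∀ i j : Fin n, E i j → C i j * x i ≤ x j) →
      ∀ j : Fin n, (⨆ i : Fin n, C i j * x i) = x j := by
    intro h j
    haveI : Nonempty (Fin n) := ⟨j⟩
    apply le_antisymm
    · apply ciSup_le
      intro i
      by_cases hij : i = j
      · subst hij
        simp [hC.diag]
      · by_cases hE : E i j
        · exact h i j hE
        · rw [hC.nonedge i j hij hE, zero_mul]
          exact (hx j).le
    · have := le_ciSup (f := fun i => C i j * x i) (Set.finite_range _).bddAbove j
      simpa [hC.diag] using this
  refine ⟨⟨key, ?_⟩, ?_⟩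
  · intro h i j _
    rw [← h j]
    exact le_ciSup (f := fun i => C i j * x i) (Set.finite_range _).bddAbove i
  · intro h
    refine ⟨x, hx, fun j => ?_⟩
    refine (key h j).symm.trans ?_
    simp only [mul_comm]
end

section
/- Let n ≥ 1, let E be an irreflexive acyclic relation on Fin n, let C be a weight matrix for E, let C* be its Kleene star, and fix an edge (a,b) with E a b. Let Q := { x : Fin n → ℝ | x i > 0 for all i, and x_j ≥ C i j · x_i for every pair (i,j) with E i j } and Q' := { x : Fin n → ℝ | x i > 0 for all i, and x_j ≥ C i j · x_i for every pair (i,j) with E i j and (i,j) ≠ (a,b) }. Then Q = Q' if and only if there exists a directed path from a to b of length at least 2 whose weight is at least C a b. (Equivalently, the inequality x_b ≥ C a b · x_a defines a facet of the polytrope Q(C) if and only if the edge a → b is the unique optimal path from a to b.) -/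
open Finset MeasureTheory ProbabilityTheory Real
open scoped ENNReal NNReal

theorem path_extend {n : ℕ} {E : Fin n → Fin n → Prop} (C : Fin n → Fin n → ℝ) {k j : Fin n}
    {ℓ : ℕ} {v : ℕ → Fin n} (hv : v ℓ = k) (hE : ∀ m < ℓ, E (v m) (v (m + 1))) (hkj : E k j) :
    ∃ v' : ℕ → Fin n, v' 0 = v 0 ∧ v' (ℓ + 1) = j ∧ (∀ m < ℓ + 1, E (v' m) (v' (m + 1))) ∧
      ∏ m ∈ Finset.range (ℓ + 1), C (v' m) (v' (m + 1)) =
        (∏ m ∈ Finset.range ℓ, C (v m) (v (m + 1))) * C k j := by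
  refine ⟨fun m => if m ≤ ℓ then v m else j, by simp, by simp, ?_, ?_⟩
  · intro m hm
    rcases Nat.lt_succ_iff_lt_or_eq.mp hm with h | h
    · have h1 : m ≤ ℓ := h.le
      have h2 : m + 1 ≤ ℓ := h
      simpa [h1, h2] using hE m h
    · subst h
      simpa [hv] using hkj
  · rw [Finset.prod_range_succ]
    congr 1
    · refine Finset.prod_congr rfl fun m hm => ?_
      have h := Finset.mem_range.mp hm
      have h1 : m ≤ ℓ := h.le
      have h2 : m + 1 ≤ ℓ := h
      simp [h1, h2]
    · simp [hv]

theorem path_pos {n : ℕ} {E : Fin n → Fin n → Prop} {C : Fin n → Fin n → ℝ}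
    (hC : IsWeightMatrix E C) {i j : Fin n} {w : ℝ} (h : PathWeight E C i j w) : 0 < w := by
  obtain ⟨ℓ, v, -, -, -, hE, rfl⟩ := h
  exact Finset.prod_pos fun k hk => hC.edge_pos _ _ (hE k (Finset.mem_range.mp hk))

theorem star_nonneg' {n : ℕ} {E : Fin n → Fin n → Prop} {C S : Fin n → Fin n → ℝ}
    (hC : IsWeightMatrix E C) (hS : IsKleeneStar E C S) (i j : Fin n) : 0 ≤ S i j := by
  by_cases hij : i = j
  · subst hij; rw [hS.1]; norm_num
  · by_cases hp : ∃ w, PathWeight E C i j w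
    · exact (path_pos hC ((hS.2 i j hij).1 hp).1).le
    · exact ((hS.2 i j hij).2 hp).ge

theorem star_step {n : ℕ} {E : Fin n → Fin n → Prop} (hirr : ∀ i, ¬ E i i) (hacyc : Acyclic E)
    {C S : Fin n → Fin n → ℝ}
    (hC : IsWeightMatrix E C) (hS : IsKleeneStar E C S) (k i j : Fin n) (hij : E i j) :
    C i j * S k i ≤ S k j := by
  have hne : i ≠ j := fun h => hirr j (h ▸ hij)
  by_cases hki : k = i
  · subst hki
    rw [hS.1, mul_one]
    have hp : PathWeight E C k j (C k j) :=
      ⟨1, fun m => if m = 0 then k else j, le_rfl, by simp, by simp,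
        by intro m hm; obtain rfl : m = 0 := by omega
           simpa using hij, by simp⟩
    exact ((hS.2 k j hne).1 ⟨_, hp⟩).2 _ hp
  · by_cases hp : ∃ w, PathWeight E C k i w
    · obtain ⟨ℓ, v, h1, h0, hl, hE, hw⟩ := ((hS.2 k i hki).1 hp).1
      obtain ⟨v', h0', hl', hE', hw'⟩ := path_extend C hl hE hij
      have hkj : k ≠ j := by
        rintro rfl
        exact hacyc k ⟨ℓ + 1, v', by omega, h0'.trans h0, hl', hE'⟩
      have hp' : PathWeight E C k j (C i j * S k i) :=
        ⟨ℓ + 1, v', by omega, h0'.trans h0, hl', hE', by rw [hw', hw, mul_comm]⟩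
      exact ((hS.2 k j hkj).1 ⟨_, hp'⟩).2 _ hp'
    · rw [(hS.2 k i hki).2 hp, mul_zero]
      exact star_nonneg' hC hS k j

/-- The inequality of the edge `a → b` is redundant for the polytrope (i.e. `Q = Q'`) if and
only if there is a directed path from `a` to `b` of length at least `2` whose weight is at least
`C a b`. -/
theorem stmt7 {n : ℕ} (hn : 1 ≤ n) (E : Fin n → Fin n → Prop)
    (hirr : ∀ i, ¬ E i i) (hacyc : Acyclic E)
    (C S : Fin n → Fin n → ℝ) (hC : IsWeightMatrix E C) (hS : IsKleeneStar E C S)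
    (a b : Fin n) (hab : E a b) :
    ({x : Fin n → ℝ | (∀ i, 0 < x i) ∧ ∀ i j : Fin n, E i j → C i j * x i ≤ x j}
      = {x : Fin n → ℝ |
          (∀ i, 0 < x i) ∧ ∀ i j : Fin n, E i j → (i, j) ≠ (a, b) → C i j * x i ≤ x j})
    ↔ ∃ (ℓ : ℕ) (v : ℕ → Fin n), 2 ≤ ℓ ∧ v 0 = a ∧ v ℓ = b ∧
        (∀ k < ℓ, E (v k) (v (k + 1))) ∧
        C a b ≤ ∏ k ∈ Finset.range ℓ, C (v k) (v (k + 1)) := by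
  have hane : a ≠ b := fun h => hirr b (h ▸ hab)
  have hCab := hC.edge_pos a b hab
  constructor
  · intro hQ
    by_contra hno
    have hstrict : ∀ i, E i b → i ≠ a → C i b * S a i < C a b * S a a := by
      intro i hib hia
      rw [hS.1, mul_one]
      by_cases hp : ∃ w, PathWeight E C a i w
      · obtain ⟨ℓ, v, h1, h0, hl, hE, hw⟩ := ((hS.2 a i hia.symm).1 hp).1
        obtain ⟨v', h0', hl', hE', hw'⟩ := path_extend C hl hE hib
        by_contra hlt
        refine hno ⟨ℓ + 1, v', by omega, h0'.trans h0, hl', hE', ?_⟩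
        rw [hw', ← hw, mul_comm]
        exact not_lt.mp hlt
      · rw [(hS.2 a i hia.symm).2 hp, mul_zero]
        exact hCab
    let y : Fin n → ℝ := fun i => ∑ k, S k i
    have hypos : ∀ i, 0 < y i := fun i =>
      lt_of_lt_of_le (by rw [hS.1 i]; norm_num)
        (Finset.single_le_sum (f := fun k => S k i) (fun k _ => star_nonneg' hC hS k i)
          (Finset.mem_univ i))
    have hy : ∀ i j, E i j → C i j * y i ≤ y j := fun i j hij => by
      simp only [y, Finset.mul_sum]
      exact Finset.sum_le_sum fun k _ => star_step hirr hacyc hC hS k i j hij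
    have hev : ∀ᶠ ε : ℝ in nhdsWithin 0 (Set.Ioi 0), ∀ i, E i b → i ≠ a →
        C i b * (S a i + ε * y i) < C a b * (S a a + ε * y a) := by
      rw [Filter.eventually_all]
      intro i
      by_cases hib : E i b
      · by_cases hia : i = a
        · simp [hia]
        · have hc1 : Continuous fun ε : ℝ => C i b * (S a i + ε * y i) := by fun_prop
          have hc2 : Continuous fun ε : ℝ => C a b * (S a a + ε * y a) := by fun_prop
          have := (isOpen_lt hc1 hc2).mem_nhds
            (show (0 : ℝ) ∈ {ε : ℝ | C i b * (S a i + ε * y i) < C a b * (S a a + ε * y a)} by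
              simpa using hstrict i hib hia)
          filter_upwards [mem_nhdsWithin_of_mem_nhds this] with ε h _ _ using h
      · simp [hib]
    obtain ⟨ε, hε, hεpos⟩ := (hev.and self_mem_nhdsWithin).exists
    have hεpos : 0 < ε := hεpos
    let z : Fin n → ℝ := fun i => S a i + ε * y i
    have hzpos : ∀ i, 0 < z i := fun i =>
      add_pos_of_nonneg_of_pos (star_nonneg' hC hS a i) (mul_pos hεpos (hypos i))
    have hz : ∀ i j, E i j → C i j * z i ≤ z j := fun i j hij => by
      have h1 := star_step hirr hacyc hC hS a i j hij
      have h2 := mul_le_mul_of_nonneg_left (hy i j hij) hεpos.le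
      simp only [z]
      linarith
    have hzs : ∀ i, E i b → i ≠ a → C i b * z i < C a b * z a := hε
    have hev2 : ∀ᶠ t : ℝ in nhdsWithin (C a b * z a) (Set.Iio (C a b * z a)),
        0 < t ∧ ∀ i, E i b → i ≠ a → C i b * z i < t := by
      refine Filter.Eventually.and ?_ ?_
      · exact mem_nhdsWithin_of_mem_nhds (lt_mem_nhds (mul_pos hCab (hzpos a)))
      · rw [Filter.eventually_all]
        intro i
        by_cases hib : E i b
        · by_cases hia : i = a
          · simp [hia]
          · filter_upwards [mem_nhdsWithin_of_mem_nhds (lt_mem_nhds (hzs i hib hia))]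
              with t h _ _ using h
        · simp [hib]
    obtain ⟨t, ⟨ht0, ht⟩, htlt⟩ := (hev2.and self_mem_nhdsWithin).exists
    have htlt : t < C a b * z a := htlt
    have hmem : Function.update z b t ∈ {x : Fin n → ℝ |
          (∀ i, 0 < x i) ∧ ∀ i j : Fin n, E i j → (i, j) ≠ (a, b) → C i j * x i ≤ x j} := by
      refine ⟨fun i => ?_, fun i j hij hne => ?_⟩
      · by_cases hi : i = b
        · subst hi; simpa using ht0
        · simpa [hi] using hzpos i
      · by_cases hj : j = b
        · subst hj
          have hi : i ≠ j := fun h => hirr j (h ▸ hij)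
          have hia : i ≠ a := fun h => hne (by rw [h])
          simpa [hi] using (ht i hij hia).le
        · by_cases hi : i = b
          · subst hi
            have h1 := mul_le_mul_of_nonneg_left (htlt.le.trans (hz a i hab))
              (hC.edge_pos i j hij).le
            simpa [hj] using h1.trans (hz i j hij)
          · simpa [hi, hj] using hz i j hij
    rw [← hQ] at hmem
    have := hmem.2 a b hab
    simp [hane] at this
    linarith
  · rintro ⟨ℓ, v, h2, h0, hl, hE, hw⟩
    ext x
    refine ⟨fun h => ⟨h.1, fun i j hij _ => h.2 i j hij⟩, fun h => ⟨h.1, fun i j hij => ?_⟩⟩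
    by_cases hne : (i, j) = (a, b)
    · obtain ⟨rfl, rfl⟩ := Prod.mk.inj hne
      have hstep : ∀ k < ℓ, C (v k) (v (k + 1)) * x (v k) ≤ x (v (k + 1)) := by
        intro k hk
        refine h.2 _ _ (hE k hk) fun he => ?_
        obtain ⟨he1, he2⟩ := Prod.mk.inj he
        rcases Nat.eq_zero_or_pos k with rfl | hk0
        · exact hacyc j ⟨ℓ - 1, fun m => v (m + 1), by omega, he2,
            by simpa [Nat.sub_add_cancel (show 1 ≤ ℓ by omega)] using hl,
            fun m hm => hE (m + 1) (by omega)⟩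
        · exact hacyc i ⟨k, v, hk0, h0, he1, fun m hm => hE m (by omega)⟩
      have hind : ∀ k ≤ ℓ, (∏ m ∈ Finset.range k, C (v m) (v (m + 1))) * x i ≤ x (v k) := by
        intro k
        induction k with
        | zero => intro _; simp [h0]
        | succ k ih =>
          intro hk
          rw [Finset.prod_range_succ]
          have h3 := mul_le_mul_of_nonneg_left (ih (by omega))
            (hC.edge_pos _ _ (hE k (by omega))).le
          have h4 := hstep k (by omega)
          linarith
      have h5 := hind ℓ le_rfl
      rw [hl] at h5
      exact (mul_le_mul_of_nonneg_right hw (h.1 i).le).trans h5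
    · exact h.2 i j hij hne
end

section
/- Let n ≥ 1, let E be an irreflexive acyclic relation on Fin n, let C be a weight matrix for E, let C* be its Kleene star, and let i be an ancestor of j. Then for every common ancestor k of i and j, log(C* k j) − log(C* k i) ≥ log(C* i j); that is, ω_{ij} is the smallest of the atom locations ω_{kj} − ω_{ki} of Y_{ij}, so the leftmost Gaussian mixture component of the noisy difference Y_{ij} + (ε_j − ε_i) is centered at the parameter ω_{ij}. -/
open Finset MeasureTheory ProbabilityTheory Real
open scoped ENNReal NNReal

/-- Concatenation of two directed paths multiplies the weights. -/
lemma PathWeight.concat {n : ℕ} {E : Fin n → Fin n → Prop} {C : Fin n → Fin n → ℝ}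
    {a b c : Fin n} {x y : ℝ} (h1 : PathWeight E C a b x) (h2 : PathWeight E C b c y) :
    PathWeight E C a c (x * y) := by
  obtain ⟨l, v, hl, v0, vl, hv, rfl⟩ := h1
  obtain ⟨m, u, hm, u0, um, hu, rfl⟩ := h2
  have hlow : ∀ k, k ≤ l → (if k ≤ l then v k else u (k - l)) = v k := fun k hk => if_pos hk
  have hhigh : ∀ k, (if l + k ≤ l then v (l + k) else u (l + k - l)) = u k := by
    intro k
    split_ifs with h
    · obtain rfl : k = 0 := by omega
      simp [vl, u0]
    · simp
  refine ⟨l + m, fun k => if k ≤ l then v k else u (k - l), by omega, ?_, ?_, ?_, ?_⟩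
  · simpa using v0
  · exact (hhigh m).trans um
  · intro k hk
    rcases lt_or_ge k l with h | h
    · show E (if k ≤ l then v k else u (k - l)) (if k + 1 ≤ l then v (k + 1) else u (k + 1 - l))
      rw [hlow k h.le, hlow (k + 1) h]
      exact hv k h
    · obtain ⟨t, rfl⟩ := Nat.exists_eq_add_of_le h
      have := hu t (by omega)
      rw [← hhigh t, ← hhigh (t + 1)] at this
      exact this
  · rw [Finset.prod_range_add]
    congr 1
    · refine Finset.prod_congr rfl fun k hk => ?_
      have h := Finset.mem_range.1 hk
      show _ = C (if k ≤ l then v k else u (k - l)) (if k + 1 ≤ l then v (k + 1) else u (k + 1 - l))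
      rw [hlow k h.le, hlow (k + 1) h]
    · refine Finset.prod_congr rfl fun k _ => ?_
      conv_lhs => rw [← hhigh k, ← hhigh (k + 1)]
      rfl

/-- A positive off-diagonal Kleene star entry is attained by a path. -/
lemma IsKleeneStar.path {n : ℕ} {E : Fin n → Fin n → Prop} {C S : Fin n → Fin n → ℝ}
    (hS : IsKleeneStar E C S) {a b : Fin n} (hab : a ≠ b) (h : 0 < S a b) :
    PathWeight E C a b (S a b) := by
  by_cases hw : ∃ w, PathWeight E C a b w
  · exact ((hS.2 a b hab).1 hw).1
  · exact absurd ((hS.2 a b hab).2 hw) (ne_of_gt h)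

/-- If `i` is an ancestor of `j`, then for every common ancestor `k` of `i` and `j`,
`log(C* k j) − log(C* k i) ≥ log(C* i j)`: the atom `ω_{ij}` is the smallest atom location,
so the leftmost Gaussian mixture component of the noisy difference is centered at `ω_{ij}`. -/
theorem stmt18 {n : ℕ} (hn : 1 ≤ n) (E : Fin n → Fin n → Prop)
    (hirr : ∀ i, ¬ E i i) (hacyc : Acyclic E)
    (C S : Fin n → Fin n → ℝ) (hC : IsWeightMatrix E C) (hS : IsKleeneStar E C S)
    (i j : Fin n) (hij : i ≠ j) (hanc : 0 < S i j) :
    ∀ k : Fin n, 0 < S k i → 0 < S k j →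
      Real.log (S i j) ≤ Real.log (S k j) - Real.log (S k i) := by
  intro k hki hkj
  have pij := hS.path hij hanc
  by_cases h1 : k = i
  · subst h1
    simp [hS.1 k]
  have pki := hS.path h1 hki
  have pkj := pki.concat pij
  have h2 : k ≠ j := by
    rintro rfl
    obtain ⟨l, v, hl, h0, hv1, hv, -⟩ := pkj
    exact hacyc k ⟨l, v, hl, h0, hv1, hv⟩
  have hle := ((hS.2 k j h2).1 ⟨_, pkj⟩).2 _ pkj
  have := Real.log_le_log (mul_pos hki hanc) hle
  rw [Real.log_mul hki.ne' hanc.ne'] at this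
  linarith
end
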